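/- arXiv:1207.6343 — 3 statements merged into one kernel-verified Lean document; each statement's English description precedes it below -/
import Mathlib

section
/- For every natural number t there exists n such that 1 ∈ M̂G_n^{(t)}, where for a set S ⊆ ℝ one defines S^{(0)} = S and S^{(k+1)} = the set of elements of S^{(k)} that are limits of strictly increasing sequences of elements of S^{(k)}. -/
open MeasureTheory Matrix Filter Topology

noncomputable section

/-- A lattice in `ℝ^n` : a discrete cocompact additive subgroup. -/
def IsLattice {n : ℕ} (Λ : AddSubgroup (Fin n → ℝ)) : Prop :=
  DiscreteTopology Λ ∧ CompactSpace ((Fin n → ℝ) ⧸ Λ)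

/-- Covolume of a lattice in `ℝ^n` (the volume of a fundamental domain). -/
def covol {n : ℕ} (Λ : AddSubgroup (Fin n → ℝ)) : ℝ :=
  ZLattice.covolume (AddSubgroup.toIntSubmodule Λ)

/-- The symmetric box `[-a 1, a 1] × ⋯ × [-a n, a n]` is admissible for `Λ` :
its interior contains no nonzero point of `Λ`. -/
def IsAdmissible {n : ℕ} (Λ : AddSubgroup (Fin n → ℝ)) (a : Fin n → ℝ) : Prop :=
  ∀ v ∈ Λ, v ≠ 0 → ¬ (∀ i, |v i| < a i)

/-- The set of normalized volumes `Vol(B)/(2^n Vol(Λ)) = (∏ a i)/covol Λ` of admissible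
symmetric boxes for `Λ`. -/
def mordellSet {n : ℕ} (Λ : AddSubgroup (Fin n → ℝ)) : Set ℝ :=
  {k | ∃ a : Fin n → ℝ, (∀ i, 0 < a i) ∧ IsAdmissible Λ a ∧ k = (∏ i, a i) / covol Λ}

/-- The Mordell constant `κ(Λ)` of a lattice in `ℝ^n`. -/
def mordell {n : ℕ} (Λ : AddSubgroup (Fin n → ℝ)) : ℝ := sSup (mordellSet Λ)

/-- A decomposable lattice : it splits as a direct sum `Λ = (Λ ∩ ℝ^{s}) ⊕ (Λ ∩ ℝ^{sᶜ})`
along a partition of the coordinates into two nonempty sets. -/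
def Decomposable {n : ℕ} (Λ : AddSubgroup (Fin n → ℝ)) : Prop :=
  ∃ s : Set (Fin n), s.Nonempty ∧ sᶜ.Nonempty ∧ ∀ v ∈ Λ, s.indicator v ∈ Λ

/-- The reduced Mordell–Gruber spectrum : Mordell constants of indecomposable lattices. -/
def MGhat (n : ℕ) : Set ℝ :=
  {r | ∃ Λ : AddSubgroup (Fin n → ℝ), IsLattice Λ ∧ ¬ Decomposable Λ ∧ r = mordell Λ}

/-- Iterated derived sets with respect to increasing limits:
`S^(0) = S` and `S^(k+1)` is the set of elements of `S^(k)` which are limits of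
strictly increasing sequences of elements of `S^(k)`. -/
def incrDeriv (S : Set ℝ) : ℕ → Set ℝ
  | 0 => S
  | (k+1) => {x | x ∈ incrDeriv S k ∧
      ∃ u : ℕ → ℝ, (∀ m, u m ∈ incrDeriv S k) ∧ StrictMono u ∧
        Tendsto u atTop (𝓝 x)}

/-- The vector `A m` for an integer vector `m`. -/
def latVec {ι : Type*} [Fintype ι] (A : Matrix ι ι ℝ) (m : ι → ℤ) : ι → ℝ :=
  A *ᵥ fun j => (m j : ℝ)

/-- The box with half side lengths `a` is admissible for the lattice `A ℤ^ι`. -/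
def MatAdm {ι : Type*} [Fintype ι] (A : Matrix ι ι ℝ) (a : ι → ℝ) : Prop :=
  ∀ m : ι → ℤ, m ≠ 0 → ∃ i, a i ≤ |latVec A m i|

/-- Normalized volumes of the admissible boxes of the lattice `A ℤ^ι`. -/
def ratioSet {ι : Type*} [Fintype ι] [DecidableEq ι] (A : Matrix ι ι ℝ) : Set ℝ :=
  {q | ∃ a : ι → ℝ, (∀ i, 0 < a i) ∧ MatAdm A a ∧ q = (∏ i, a i) / |A.det|}

/-- The lattice `A ℤ^ι` does not split along a partition of the coordinates. -/
def MatIndec {ι : Type*} [Fintype ι] (A : Matrix ι ι ℝ) : Prop :=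
  ∀ s : Set ι, s.Nonempty → sᶜ.Nonempty →
    ∃ m : ι → ℤ, ∀ m' : ι → ℤ, s.indicator (latVec A m) ≠ latVec A m'

/-- The basis of `ℝ^ι` formed by the columns of an invertible matrix. -/
def colBasis {ι : Type*} [Fintype ι] [DecidableEq ι] (A : Matrix ι ι ℝ) (hA : A.det ≠ 0) :
    Module.Basis ι ℝ (ι → ℝ) :=
  (Pi.basisFun ℝ ι).map (Matrix.toLinearEquiv (Pi.basisFun ℝ ι) A hA.isUnit)

lemma colBasis_apply {ι : Type*} [Fintype ι] [DecidableEq ι] (A : Matrix ι ι ℝ)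
    (hA : A.det ≠ 0) (i j : ι) : colBasis A hA j i = A i j := by
  simp [colBasis, Matrix.toLinearEquiv, Matrix.toLin_eq_toLin', Matrix.toLin'_apply]

lemma of_colBasis {ι : Type*} [Fintype ι] [DecidableEq ι] (A : Matrix ι ι ℝ)
    (hA : A.det ≠ 0) : Matrix.of (colBasis A hA) = Aᵀ := by
  ext i j
  simp [colBasis_apply]

lemma mem_span_colBasis {ι : Type*} [Fintype ι] [DecidableEq ι] {A : Matrix ι ι ℝ}
    {hA : A.det ≠ 0} {v : ι → ℝ} :
    v ∈ Submodule.span ℤ (Set.range (colBasis A hA)) ↔ ∃ m : ι → ℤ, latVec A m = v := by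
  rw [Submodule.mem_span_range_iff_exists_fun]
  refine exists_congr fun m => ?_
  have : ∑ i, m i • colBasis A hA i = latVec A m := by
    ext i
    simp [latVec, Matrix.mulVec, dotProduct, colBasis_apply, Finset.sum_apply, mul_comm]
  rw [this]

lemma latVec_zero {ι : Type*} [Fintype ι] (A : Matrix ι ι ℝ) : latVec A 0 = 0 := by
  ext i; simp [latVec, Matrix.mulVec, dotProduct]

lemma latVec_injective {ι : Type*} [Fintype ι] [DecidableEq ι] {A : Matrix ι ι ℝ}
    (hA : A.det ≠ 0) : Function.Injective (latVec A) := by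
  intro m m' h
  have := Matrix.mulVec_injective_of_isUnit (A := A)
    ((Matrix.isUnit_iff_isUnit_det A).2 hA.isUnit) h
  ext i
  exact_mod_cast congrFun this i

/-- The Minkowski convex body theorem for boxes. -/
lemma MatAdm.prod_le_det {ι : Type*} [Fintype ι] [DecidableEq ι] {A : Matrix ι ι ℝ}
    (hA : A.det ≠ 0) {a : ι → ℝ} (ha : ∀ i, 0 < a i) (h : MatAdm A a) :
    ∏ i, a i ≤ |A.det| := by
  by_contra! hlt
  let b := colBasis A hA
  let L := (Submodule.span ℤ (Set.range b)).toAddSubgroup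
  have hfund := ZSpan.isAddFundamentalDomain' b (volume : Measure (ι → ℝ))
  have : Countable L := inferInstanceAs (Countable (Submodule.span ℤ (Set.range b)))
  obtain ⟨x, hx0, hx⟩ := exists_ne_zero_mem_lattice_of_measure_mul_two_pow_lt_measure
    (s := Set.univ.pi fun i => Set.Ioo (-a i) (a i)) hfund
    (by
      intro x hx i hi
      have := hx i hi
      simp only [Set.mem_Ioo, Pi.neg_apply] at this ⊢
      constructor <;> linarith)
    (convex_pi fun i _ => convex_Ioo _ _)
    (by
      rw [ZSpan.volume_fundamentalDomain, of_colBasis, Matrix.det_transpose, volume_pi,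
        Measure.pi_pi]
      simp only [Real.volume_Ioo, sub_neg_eq_add, Module.finrank_fintype_fun_eq_card]
      rw [← ENNReal.ofReal_prod_of_nonneg (fun i _ => by linarith [ha i])]
      have h2 : ∏ i, (a i + a i) = (∏ i, a i) * 2 ^ Fintype.card ι := by
        simp_rw [← mul_two, Finset.prod_mul_distrib]
        simp
      rw [h2, ENNReal.ofReal_mul (Finset.prod_nonneg fun i _ => (ha i).le),
        ENNReal.ofReal_pow (by norm_num), ENNReal.ofReal_ofNat]
      refine ENNReal.mul_lt_mul_left (by positivity) (by finiteness) ?_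
      exact (ENNReal.ofReal_lt_ofReal_iff (lt_of_le_of_lt (abs_nonneg _) hlt)).2 hlt)
  obtain ⟨m, hm⟩ := mem_span_colBasis.1 x.2
  have hm0 : m ≠ 0 := by
    rintro rfl
    exact hx0 (Subtype.ext (by rw [← hm, latVec_zero]; rfl))
  obtain ⟨i, hi⟩ := h m hm0
  have := hx i (Set.mem_univ i)
  rw [← hm] at this
  exact absurd (abs_lt.2 this) (not_lt.2 hi)

lemma isLattice_span_colBasis {n : ℕ} (A : Matrix (Fin n) (Fin n) ℝ) (hA : A.det ≠ 0) :
    IsLattice (Submodule.span ℤ (Set.range (colBasis A hA))).toAddSubgroup := by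
  refine ⟨inferInstance, ?_⟩
  set b := colBasis A hA
  set L := (Submodule.span ℤ (Set.range b)).toAddSubgroup
  refine ⟨?_⟩
  have hc : IsCompact (closure (ZSpan.fundamentalDomain b)) :=
    (ZSpan.fundamentalDomain_isBounded b).isCompact_closure
  have hcont : Continuous (QuotientAddGroup.mk : (Fin n → ℝ) → (Fin n → ℝ) ⧸ L) :=
    continuous_quotient_mk'
  convert hc.image hcont
  symm
  refine Set.eq_univ_of_forall fun q => ?_
  obtain ⟨x, rfl⟩ := QuotientAddGroup.mk_surjective q
  refine ⟨ZSpan.fract b x, subset_closure (ZSpan.fract_mem_fundamentalDomain b x), ?_⟩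
  rw [QuotientAddGroup.eq, ZSpan.fract_apply]
  simp

lemma covol_span_colBasis {n : ℕ} (A : Matrix (Fin n) (Fin n) ℝ) (hA : A.det ≠ 0) :
    covol (Submodule.span ℤ (Set.range (colBasis A hA))).toAddSubgroup = |A.det| := by
  have h := ZLattice.covolume_eq_measure_fundamentalDomain
    (Submodule.span ℤ (Set.range (colBasis A hA))) volume
    (ZSpan.isAddFundamentalDomain (colBasis A hA) volume)
  rw [measureReal_def, ZSpan.volume_fundamentalDomain, of_colBasis, Matrix.det_transpose,
    ENNReal.toReal_ofReal (abs_nonneg _)] at h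
  exact h

lemma sSup_ratioSet_mem_MGhat_fin {n : ℕ} (A : Matrix (Fin n) (Fin n) ℝ) (hA : A.det ≠ 0)
    (hi : MatIndec A) : sSup (ratioSet A) ∈ MGhat n := by
  refine ⟨_, isLattice_span_colBasis A hA, ?_, ?_⟩
  · rintro ⟨s, hs, hs', h⟩
    obtain ⟨m, hm⟩ := hi s hs hs'
    obtain ⟨m', hm'⟩ := mem_span_colBasis.1 (h _ (mem_span_colBasis.2 ⟨m, rfl⟩))
    exact hm m' hm'.symm
  · rw [mordell]
    congr 1
    ext q
    refine exists_congr fun a => and_congr_right fun ha => ?_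
    rw [covol_span_colBasis]
    refine and_congr_left fun _ => ?_
    constructor
    · rintro h v hv hv0 hlt
      obtain ⟨m, rfl⟩ := mem_span_colBasis.1 hv
      obtain ⟨i, hi⟩ := h m (by rintro rfl; exact hv0 (latVec_zero A))
      exact absurd (hlt i) (not_lt.2 hi)
    · intro h m hm
      have := h (latVec A m) (mem_span_colBasis.2 ⟨m, rfl⟩) (by
        rw [← latVec_zero A]
        exact (latVec_injective hA).ne hm)
      simpa using this

lemma latVec_submatrix {ι κ : Type*} [Fintype ι] [Fintype κ] (A : Matrix ι ι ℝ) (e : κ ≃ ι)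
    (m : κ → ℤ) : latVec (A.submatrix e e) m = latVec A (m ∘ e.symm) ∘ e := by
  rw [latVec, Matrix.submatrix_mulVec_equiv]
  rfl

lemma sSup_ratioSet_mem_MGhat {ι : Type*} [Fintype ι] [DecidableEq ι] (A : Matrix ι ι ℝ)
    (hA : A.det ≠ 0) (hi : MatIndec A) : sSup (ratioSet A) ∈ MGhat (Fintype.card ι) := by
  let e : Fin (Fintype.card ι) ≃ ι := (Fintype.equivFin ι).symm
  have hdet : (A.submatrix e e).det = A.det := Matrix.det_submatrix_equiv_self e A
  have hadm : ∀ a : ι → ℝ, MatAdm (A.submatrix e e) (a ∘ e) ↔ MatAdm A a := by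
    intro a
    constructor
    · intro h m hm
      obtain ⟨i, hi⟩ := h (m ∘ e) (by
        intro h0
        exact hm (funext fun i => by simpa using congrFun h0 (e.symm i)))
      refine ⟨e i, ?_⟩
      simpa [latVec_submatrix, Function.comp_assoc] using hi
    · intro h m hm
      obtain ⟨i, hi⟩ := h (m ∘ e.symm) (by
        intro h0
        exact hm (funext fun i => by simpa using congrFun h0 (e i)))
      refine ⟨e.symm i, ?_⟩
      simpa [latVec_submatrix] using hi
  have hset : ratioSet (A.submatrix e e) = ratioSet A := by
    ext q
    simp only [ratioSet, Set.mem_ofPred_eq, hdet]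
    constructor
    · rintro ⟨a, ha, h, rfl⟩
      refine ⟨a ∘ e.symm, fun i => ha _, (hadm _).1 (by simpa [Function.comp_assoc] using h), ?_⟩
      simp [Equiv.prod_comp]
    · rintro ⟨a, ha, h, rfl⟩
      refine ⟨a ∘ e, fun i => ha _, (hadm _).2 h, ?_⟩
      simp [Equiv.prod_comp]
  rw [← hset]
  refine sSup_ratioSet_mem_MGhat_fin _ (hdet ▸ hA) ?_
  intro s hs hs'
  obtain ⟨m, hm⟩ := hi (e '' s) (hs.image e) (by
    rw [← Set.image_compl_eq e.bijective]; exact hs'.image e)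
  refine ⟨m ∘ e, fun m' hm' => hm (m' ∘ e.symm) ?_⟩
  rw [latVec_submatrix, latVec_submatrix] at hm'
  funext i
  obtain ⟨j, rfl⟩ := e.surjective i
  have := congrFun hm' j
  by_cases hj : j ∈ s
  · simpa [hj, Function.comp_assoc] using this
  · simpa [hj, Function.comp_assoc] using this

lemma exists_int_sign (x : ℝ) : ∃ s : ℤ, (s : ℝ) * s = 1 ∧ s * x = |x| := by
  rcases le_total 0 x with h | h
  · exact ⟨1, by simp, by simp [abs_of_nonneg h]⟩
  · exact ⟨-1, by simp, by simp [abs_of_nonpos h]⟩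

lemma latVec_fin_two (D : Matrix (Fin 2) (Fin 2) ℝ) (m : Fin 2 → ℤ) (i : Fin 2) :
    latVec D m i = D i 0 * m 0 + D i 1 * m 1 := by
  simp [latVec, Matrix.mulVec, dotProduct, Fin.sum_univ_two]

/-- If `(X₁, Y₁)`, `(X₂, Y₂)` is a suitably reduced basis of a planar lattice of covolume `V`
on which the product of the coordinates is bounded below, then admissible boxes have area
bounded away from the maximal one. -/
lemma box_le_of_reduced_basis {V a b c X₁ Y₁ X₂ Y₂ : ℝ} (hV : 0 < V) (ha : 0 < a) (hb : 0 < b)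
    (hX : a ≤ X₁) (hX' : X₁ < (1 + c / 2) * a) (hY : 0 < Y₁)
    (hYb : Y₁ < b) (h2 : -X₁ < X₂) (h2' : X₂ ≤ 0) (hdet : X₁ * Y₂ - X₂ * Y₁ = V)
    (hadm : a ≤ |X₂| ∨ b ≤ |Y₂|) (hc : 0 < c) (hn2 : c * V ≤ |X₂ * Y₂|) (hn1 : c * V ≤ X₁ * Y₁)
    (hn12 : c * V ≤ |(X₁ + X₂) * (Y₁ + Y₂)|) (hab : a * b ≤ V) :
    a * b ≤ (1 - c ^ 2) * V := by
  obtain ⟨t, rfl⟩ : ∃ t, X₂ = -t := ⟨-X₂, by ring⟩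
  have ht : 0 ≤ t := by linarith
  have hX1 : 0 < X₁ := by linarith
  have hpos : 0 < Y₁ + Y₂ := by
    by_contra! h
    nlinarith [mul_nonneg hX1.le (neg_nonneg.2 h), mul_pos (show 0 < X₁ - t by linarith) hY]
  by_cases hb2 : b ≤ Y₂
  · have h1 : |(-t) * Y₂| = t * Y₂ := by
      rw [neg_mul, abs_neg, abs_of_nonneg]
      exact mul_nonneg ht (by linarith)
    rw [h1] at hn2
    have h3 : 0 ≤ t * Y₁ := mul_nonneg ht hY.le
    have h4 : (c * V) * (c * V) ≤ (t * Y₂) * (X₁ * Y₁) :=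
      mul_le_mul hn2 hn1 (by positivity) (mul_nonneg ht (by linarith))
    have h5 : (X₁ * Y₂) * (t * Y₁) ≤ V * (t * Y₁) :=
      mul_le_mul_of_nonneg_right (by linarith) h3
    have h6 : V * (c ^ 2 * V) ≤ V * (t * Y₁) := by nlinarith
    have h7 := le_of_mul_le_mul_left h6 hV
    have h8 : a * b ≤ X₁ * Y₂ := mul_le_mul hX hb2 hb.le hX1.le
    linarith
  · exfalso
    have hb3 : |Y₂| < b := abs_lt.2 ⟨by linarith, by linarith⟩
    have hat : a ≤ t := by
      rcases hadm with h | h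
      · rwa [abs_neg, abs_of_nonneg ht] at h
      · linarith
    rw [abs_of_pos (mul_pos (by linarith) hpos)] at hn12
    have h1 : (X₁ + -t) * (Y₁ + Y₂) < (c / 2 * a) * (2 * b) :=
      mul_lt_mul'' (by linarith) (by linarith) (by linarith) hpos.le
    nlinarith

/-- A planar lattice on which the product of the coordinates is bounded away from zero has Mordell
constant less than one. -/
lemma exists_gap_of_norm_ge {D : Matrix (Fin 2) (Fin 2) ℝ} (hD : D.det ≠ 0) {c : ℝ} (hc : 0 < c)
    (hn : ∀ m : Fin 2 → ℤ, m ≠ 0 → c * |D.det| ≤ |latVec D m 0 * latVec D m 1|) :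
    ∃ δ > 0, ∀ q ∈ ratioSet D, q ≤ 1 - δ := by
  wlog hc1 : c ≤ 1 generalizing c
  · refine this one_pos (fun m hm => le_trans ?_ (hn m hm)) le_rfl
    gcongr
    linarith
  refine ⟨c ^ 2 / 4, by positivity, ?_⟩
  rintro q ⟨a, ha, hadm, rfl⟩
  have hV : 0 < |D.det| := abs_pos.2 hD
  rw [div_le_iff₀ hV, Fin.prod_univ_two]
  have hab := hadm.prod_le_det hD ha
  rw [Fin.prod_univ_two] at hab
  by_contra! hlt
  have hnot : ¬ MatAdm D ![(1 + c / 2) * a 0, a 1] := by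
    intro h
    have := h.prod_le_det hD (by
      intro i
      fin_cases i
      · exact mul_pos (by positivity) (ha 0)
      · exact ha 1)
    simp only [Fin.prod_univ_two, Matrix.cons_val_zero, Matrix.cons_val_one] at this
    have h1 : (1 + c / 2) * ((1 - c ^ 2 / 4) * |D.det|) < (1 + c / 2) * (a 0 * a 1) :=
      mul_lt_mul_of_pos_left hlt (by positivity)
    have h2 : 1 ≤ (1 + c / 2) * (1 - c ^ 2 / 4) := by nlinarith [mul_pos hc hc]
    nlinarith
  simp only [MatAdm, not_forall, not_exists, not_le] at hnot
  obtain ⟨m, hm, hmlt⟩ := hnot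
  have hx' : |latVec D m 0| < (1 + c / 2) * a 0 := by simpa using hmlt 0
  have hy' : |latVec D m 1| < a 1 := by simpa using hmlt 1
  have hx : a 0 ≤ |latVec D m 0| := by
    obtain ⟨i, hi⟩ := hadm m hm
    fin_cases i
    · exact hi
    · exact absurd hy' (not_lt.2 hi)
  have hgcd : Int.gcd (m 0) (m 1) = 1 := by
    obtain ⟨u, hu⟩ := Int.gcd_dvd_left (m 0) (m 1)
    obtain ⟨v, hv⟩ := Int.gcd_dvd_right (m 0) (m 1)
    set g := Int.gcd (m 0) (m 1)
    by_contra hg1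
    have hg0 : g ≠ 0 := by
      intro h0
      refine hm (funext fun i => ?_)
      fin_cases i
      · simpa [h0] using hu
      · simpa [h0] using hv
    have hg2 : (2 : ℝ) ≤ g := by exact_mod_cast (show 2 ≤ g by omega)
    have hlat : ∀ i, latVec D m i = g * latVec D ![u, v] i := by
      intro i
      rw [latVec_fin_two, latVec_fin_two, hu, hv]
      simp only [Matrix.cons_val_zero, Matrix.cons_val_one]
      push_cast
      ring
    have h0 : (![u, v] : Fin 2 → ℤ) ≠ 0 := by
      intro h0
      refine hm (funext fun i => ?_)
      have hu0 : u = 0 := by simpa using congrFun h0 0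
      have hv0 : v = 0 := by simpa using congrFun h0 1
      fin_cases i
      · simpa [hu0] using hu
      · simpa [hv0] using hv
    obtain ⟨i, hi⟩ := hadm _ h0
    rw [hlat, abs_mul, Nat.abs_cast] at hx' hy'
    fin_cases i
    · replace hi : a 0 ≤ |latVec D ![u, v] 0| := hi
      nlinarith [ha 0, mul_le_mul hg2 hi (ha 0).le (by linarith)]
    · replace hi : a 1 ≤ |latVec D ![u, v] 1| := hi
      nlinarith [ha 1, mul_le_mul hg2 hi (ha 1).le (by linarith)]
  have hbez := Int.gcd_eq_gcd_ab (m 0) (m 1)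
  rw [hgcd] at hbez
  generalize Int.gcdA (m 0) (m 1) = p at hbez
  generalize Int.gcdB (m 0) (m 1) = r at hbez
  have hbez' : (1 : ℝ) = m 0 * p + m 1 * r := by exact_mod_cast hbez
  obtain ⟨s₁, hs₁, hs₁'⟩ := exists_int_sign (latVec D m 0)
  obtain ⟨s₂, hs₂, hs₂'⟩ := exists_int_sign (latVec D m 1)
  obtain ⟨s₃, hs₃, hs₃'⟩ := exists_int_sign D.det
  have habs : ∀ (s : ℤ) (x : ℝ), (s : ℝ) * s = 1 → |(s : ℝ) * x| = |x| := by
    intro s x hs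
    have : |(s : ℝ)| = 1 := by
      have h1 : |(s : ℝ)| * |(s : ℝ)| = 1 := by rw [← abs_mul, hs, abs_one]
      nlinarith [abs_nonneg (s : ℝ)]
    rw [abs_mul, this, one_mul]
  let k : ℤ := ⌊-(s₁ * (s₁ * s₂ * s₃ * latVec D ![-r, p] 0)) / |latVec D m 0|⌋
  let w : Fin 2 → ℤ := ![-(s₁ * s₂ * s₃ * r) + k * m 0, s₁ * s₂ * s₃ * p + k * m 1]
  have hw : ∀ i, latVec D w i = s₁ * s₂ * s₃ * latVec D ![-r, p] i + k * latVec D m i := by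
    intro i
    simp only [latVec_fin_two, w, Matrix.cons_val_zero, Matrix.cons_val_one]
    push_cast
    ring
  have hmw : ∀ i, latVec D (m + w) i = latVec D m i + latVec D w i := by
    intro i
    simp only [latVec_fin_two, Pi.add_apply]
    push_cast
    ring
  have hx0 : 0 < |latVec D m 0| := lt_of_lt_of_le (ha 0) hx
  have hdet : latVec D m 0 * latVec D ![-r, p] 1 - latVec D ![-r, p] 0 * latVec D m 1 = D.det := by
    rw [Matrix.det_fin_two]
    simp only [latVec_fin_two, Matrix.cons_val_zero, Matrix.cons_val_one]
    push_cast
    linear_combination (-(D 0 0 * D 1 1 - D 0 1 * D 1 0)) * hbez'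
  have hdetw : latVec D m 0 * latVec D w 1 - latVec D w 0 * latVec D m 1
      = s₁ * s₂ * s₃ * D.det := by
    rw [hw, hw, ← hdet]; ring
  have hsx : (s₁ : ℝ) * latVec D w 0
      = s₁ * (s₁ * s₂ * s₃ * latVec D ![-r, p] 0) + k * |latVec D m 0| := by
    rw [hw, ← hs₁']; ring
  have hk1 := Int.floor_le (-(s₁ * (s₁ * s₂ * s₃ * latVec D ![-r, p] 0)) / |latVec D m 0|)
  have hk2 := Int.lt_floor_add_one (-(s₁ * (s₁ * s₂ * s₃ * latVec D ![-r, p] 0)) / |latVec D m 0|)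
  rw [le_div_iff₀ hx0] at hk1
  rw [div_lt_iff₀ hx0] at hk2
  have hdetV : |latVec D m 0| * (s₂ * latVec D w 1) - s₁ * latVec D w 0 * |latVec D m 1|
      = |D.det| := by
    rw [← hs₁', ← hs₂', ← hs₃']
    linear_combination (s₁ * s₂ : ℝ) * hdetw + s₃ * D.det * (s₂ * s₂) * hs₁ + s₃ * D.det * hs₂
  have hw0 : w ≠ 0 := by
    intro h0
    rw [h0, latVec_zero] at hdetV
    simp only [Pi.zero_apply, mul_zero, zero_mul, sub_zero] at hdetV
    exact hV.ne hdetV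
  have hmw0 : m + w ≠ 0 := by
    intro h0
    have h1 := hmw 0
    have h2 := hmw 1
    rw [h0, latVec_zero] at h1 h2
    simp only [Pi.zero_apply] at h1 h2
    have h3 : latVec D w 0 = - latVec D m 0 := by linarith
    have h4 : latVec D w 1 = - latVec D m 1 := by linarith
    rw [h3, h4, ← hs₁', ← hs₂'] at hdetV
    exact hV.ne (by linarith)
  have hnm := hn m hm
  have hy0 : 0 < |latVec D m 1| := by
    rw [abs_mul] at hnm
    by_contra! h
    have h1 : |latVec D m 1| = 0 := le_antisymm h (abs_nonneg _)
    rw [h1, mul_zero] at hnm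
    nlinarith [mul_pos hc hV]
  have := box_le_of_reduced_basis (c := c) hV (ha 0) (ha 1) hx hx' hy0 hy'
    (X₂ := s₁ * latVec D w 0) (Y₂ := s₂ * latVec D w 1) (by rw [hsx]; linarith)
    (by rw [hsx]; linarith) hdetV
    (by
      rw [habs _ _ hs₁, habs _ _ hs₂]
      obtain ⟨i, hi⟩ := hadm w hw0
      fin_cases i
      · exact Or.inl hi
      · exact Or.inr hi) hc
    (by rw [abs_mul, habs _ _ hs₁, habs _ _ hs₂, ← abs_mul]; exact hn w hw0)
    (by rw [← abs_mul]; exact hnm)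
    (by
      rw [← hs₁', ← hs₂', ← mul_add, ← mul_add, abs_mul, habs _ _ hs₁, habs _ _ hs₂, ← abs_mul,
        ← hmw, ← hmw]
      exact hn _ hmw0) hab
  nlinarith [mul_pos hc hc, mul_pos (mul_pos hc hc) hV]

/-- The matrix obtained by halving the first column: its lattice contains the original one with
index two. -/
def halfMat (D : Matrix (Fin 2) (Fin 2) ℝ) : Matrix (Fin 2) (Fin 2) ℝ :=
  !![D 0 0 / 2, D 0 1; D 1 0 / 2, D 1 1]

lemma latVec_halfMat (D : Matrix (Fin 2) (Fin 2) ℝ) (m : Fin 2 → ℤ) (i : Fin 2) :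
    latVec (halfMat D) m i = D i 0 * (m 0 / 2) + D i 1 * m 1 := by
  fin_cases i <;> simp [latVec_fin_two, halfMat] <;> ring

lemma det_halfMat (D : Matrix (Fin 2) (Fin 2) ℝ) : (halfMat D).det = D.det / 2 := by
  simp [halfMat, Matrix.det_fin_two]; ring

lemma det_halfMat_ne_zero {D : Matrix (Fin 2) (Fin 2) ℝ} (hD : D.det ≠ 0) :
    (halfMat D).det ≠ 0 := by
  rw [det_halfMat]; exact div_ne_zero hD two_ne_zero

/-- Normalized volumes of the admissible boxes of a planar lattice or of its superlattice given by
`halfMat`. -/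
def pairSet (D : Matrix (Fin 2) (Fin 2) ℝ) : Set ℝ := ratioSet D ∪ ratioSet (halfMat D)

lemma le_one_of_mem_ratioSet {ι : Type*} [Fintype ι] [DecidableEq ι] {A : Matrix ι ι ℝ}
    (hA : A.det ≠ 0) {q : ℝ} (hq : q ∈ ratioSet A) : q ≤ 1 := by
  obtain ⟨a, ha, h, rfl⟩ := hq
  exact (div_le_one (abs_pos.2 hA)).2 (h.prod_le_det hA ha)

lemma pos_of_mem_ratioSet {ι : Type*} [Fintype ι] [DecidableEq ι] {A : Matrix ι ι ℝ}
    (hA : A.det ≠ 0) {q : ℝ} (hq : q ∈ ratioSet A) : 0 < q := by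
  obtain ⟨a, ha, h, rfl⟩ := hq
  exact div_pos (Finset.prod_pos fun i _ => ha i) (abs_pos.2 hA)

lemma le_one_of_mem_pairSet {D : Matrix (Fin 2) (Fin 2) ℝ} (hD : D.det ≠ 0) {q : ℝ}
    (hq : q ∈ pairSet D) : q ≤ 1 :=
  hq.elim (le_one_of_mem_ratioSet hD) (le_one_of_mem_ratioSet (det_halfMat_ne_zero hD))

lemma pos_of_mem_pairSet {D : Matrix (Fin 2) (Fin 2) ℝ} (hD : D.det ≠ 0) {q : ℝ}
    (hq : q ∈ pairSet D) : 0 < q :=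
  hq.elim (pos_of_mem_ratioSet hD) (pos_of_mem_ratioSet (det_halfMat_ne_zero hD))

lemma bddAbove_pairSet {D : Matrix (Fin 2) (Fin 2) ℝ} (hD : D.det ≠ 0) :
    BddAbove (pairSet D) :=
  ⟨1, fun _ hq => le_one_of_mem_pairSet hD hq⟩

/-- The matrix of a lattice in dimension `3 k + 1` gluing `k` planar lattices. -/
def glueMat {k : ℕ} (D : Fin k → Matrix (Fin 2) (Fin 2) ℝ) :
    Matrix ((Fin 2 × Fin k) ⊕ (Fin k ⊕ Unit)) ((Fin 2 × Fin k) ⊕ (Fin k ⊕ Unit)) ℝ :=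
  Matrix.fromBlocks (Matrix.blockDiagonal D)
    (Matrix.of fun p j => Sum.elim (fun j => if p.2 = j then D p.2 p.1 0 / 2 else 0) 0 j) 0
    (Matrix.fromBlocks 1 0 (Matrix.of fun _ _ => 1 / 2) 1)

section glue

variable {k : ℕ} (D : Fin k → Matrix (Fin 2) (Fin 2) ℝ)

lemma latVec_glueMat_plane (m : (Fin 2 × Fin k) ⊕ (Fin k ⊕ Unit) → ℤ) (r : Fin 2) (i : Fin k) :
    latVec (glueMat D) m (.inl (r, i)) =
      D i r 0 * (m (.inl (0, i)) + m (.inr (.inl i)) / 2) + D i r 1 * m (.inl (1, i)) := by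
  simp [latVec, glueMat, Matrix.mulVec, dotProduct, Matrix.blockDiagonal_apply,
    Fintype.sum_prod_type, Fin.sum_univ_two]
  ring

lemma latVec_glueMat_line (m : (Fin 2 × Fin k) ⊕ (Fin k ⊕ Unit) → ℤ) (i : Fin k) :
    latVec (glueMat D) m (.inr (.inl i)) = m (.inr (.inl i)) := by
  simp [latVec, glueMat, Matrix.mulVec, dotProduct, Matrix.one_apply]

lemma latVec_glueMat_unit (m : (Fin 2 × Fin k) ⊕ (Fin k ⊕ Unit) → ℤ) :
    latVec (glueMat D) m (.inr (.inr ())) =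
      (∑ i, (m (.inr (.inl i)) : ℝ)) / 2 + m (.inr (.inr ())) := by
  simp [latVec, glueMat, Matrix.mulVec, dotProduct, Finset.sum_div]
  refine Finset.sum_congr rfl fun i _ => ?_
  ring

lemma det_glueMat : (glueMat D).det = ∏ i, (D i).det := by
  simp [glueMat, Matrix.det_fromBlocks_zero₂₁, Matrix.det_blockDiagonal]

variable {D}

lemma glueMat_indec (hD : ∀ i, (D i).det ≠ 0) (hi : ∀ i, MatIndec (D i)) :
    MatIndec (glueMat D) := by
  intro s hs hs'
  by_contra! H
  have hline : ∀ i, (Sum.inr (.inl i) ∈ s ↔ Sum.inr (.inr ()) ∈ s) ∧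
      ((∀ r, Sum.inl (r, i) ∈ s) → Sum.inr (.inl i) ∈ s) ∧
      (Sum.inr (.inl i) ∈ s → ∃ r, Sum.inl (r, i) ∈ s) := by
    intro i
    have hhalf : ∀ n : ℤ, (n : ℝ) + 1 / 2 ≠ 0 := by
      intro n h
      have h2 : (2 * n + 1 : ℝ) = 0 := by linarith
      have h3 : 2 * n + 1 = 0 := by exact_mod_cast h2
      omega
    have hker : ∀ p q : ℝ, (∀ r, D i r 0 * p + D i r 1 * q = 0) → p = 0 := by
      intro p q h
      refine (mul_eq_zero.1 ?_).resolve_left (hD i)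
      rw [Matrix.det_fin_two]
      linear_combination D i 1 1 * h 0 - D i 0 1 * h 1
    obtain ⟨m', hm'⟩ := H (Sum.elim 0 (Sum.elim (Pi.single i 1) 0))
    have hL := fun j => congrFun hm' (.inr (.inl j))
    have hU := congrFun hm' (.inr (.inr ()))
    have hP := fun r => congrFun hm' (.inl (r, i))
    simp only [Set.indicator, latVec_glueMat_line] at hL
    simp only [Set.indicator, latVec_glueMat_unit] at hU
    simp only [Set.indicator, latVec_glueMat_plane] at hP
    simp only [Sum.elim_inl, Sum.elim_inr, Pi.zero_apply, Int.cast_zero] at hL hU hP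
    by_cases hs : Sum.inr (.inl i) ∈ s
    · have hz : ∀ j, (m' (.inr (.inl j)) : ℝ) = (Pi.single i 1 : Fin k → ℤ) j := by
        intro j
        rw [← hL j]
        by_cases hj : j = i
        · subst hj
          simp [hs]
        · simp [hj]
      have hsum : ∑ j, (((Pi.single i 1 : Fin k → ℤ) j : ℤ) : ℝ) = 1 := by
        rw [← Int.cast_sum]
        simp
      simp only [hz, hsum] at hU hP
      refine ⟨iff_of_true hs ?_, fun _ => hs, fun _ => ?_⟩
      · by_contra hu
        rw [if_neg hu] at hU
        exact hhalf _ (by rw [hU]; ring)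
      · by_contra! hr
        refine hhalf (m' (.inl (0, i))) (hker _ (m' (.inl (1, i))) fun r => ?_)
        have := hP r
        rw [if_neg (hr r)] at this
        simpa using this.symm
    · have hz : ∀ j, (m' (.inr (.inl j)) : ℝ) = 0 := by
        intro j
        rw [← hL j]
        by_cases hj : j = i
        · subst hj
          simp [hs]
        · simp [hj]
      simp only [hz] at hU hP
      refine ⟨iff_of_false hs fun hu => ?_, fun hr => ?_, fun h => absurd h hs⟩
      · rw [if_pos hu] at hU
        refine hhalf (-m' (.inr (.inr ()))) ?_
        rw [← Int.cast_sum] at hU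
        simp at hU
        push_cast
        linarith
      · exfalso
        refine hhalf (-m' (.inl (0, i))) (hker _ (-m' (.inl (1, i))) fun r => ?_)
        have := hP r
        rw [if_pos (hr r)] at this
        simp at this
        push_cast
        linarith
  have hplane : ∀ i r r', Sum.inl (r, i) ∈ s → Sum.inl (r', i) ∈ s := by
    intro i r r' hr
    by_contra hr'
    obtain ⟨y, hy⟩ := hi i {r | Sum.inl (r, i) ∈ s} ⟨r, hr⟩ ⟨r', hr'⟩
    obtain ⟨m', hm'⟩ := H (Sum.elim (fun p => if p.2 = i then y p.1 else 0) 0)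
    have hz : m' (.inr (.inl i)) = 0 := by
      have := congrFun hm' (.inr (.inl i))
      rw [latVec_glueMat_line] at this
      by_cases h : Sum.inr (.inl i) ∈ s
      · simpa [h, latVec_glueMat_line] using this.symm
      · simpa [h, latVec_glueMat_line] using this.symm
    refine hy (fun r => m' (.inl (r, i))) (funext fun r => ?_)
    have := congrFun hm' (.inl (r, i))
    rw [latVec_glueMat_plane, hz] at this
    rw [latVec_fin_two]
    by_cases h : Sum.inl (r, i) ∈ s
    · simp only [Set.indicator, Set.mem_ofPred_eq, h, if_true] at this ⊢
      rw [latVec_glueMat_plane] at this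
      simpa [latVec_fin_two] using this
    · simp only [Set.indicator, Set.mem_ofPred_eq, h, if_false] at this ⊢
      simpa using this
  have hall : ∀ j, j ∈ s ↔ Sum.inr (.inr ()) ∈ s := by
    rintro (⟨r, i⟩ | i | u)
    · rw [← (hline i).1]
      refine ⟨fun h => (hline i).2.1 fun r' => hplane i r r' h, fun h => ?_⟩
      obtain ⟨r', h'⟩ := (hline i).2.2 h
      exact hplane i r' r h'
    · exact (hline i).1
    · exact Iff.rfl
  obtain ⟨j, hj⟩ := hs
  obtain ⟨j', hj'⟩ := hs'
  exact hj' ((hall j').2 ((hall j).1 hj))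

lemma prod_mem_ratioSet_glueMat {q : Fin k → ℝ}
    (hq : ∀ i, q i ∈ pairSet (D i)) : ∏ i, q i ∈ ratioSet (glueMat D) := by
  have h : ∀ i, ∃ (h : ℝ) (a : Fin 2 → ℝ), (∀ r, 0 < a r) ∧ 0 < h ∧
      q i = (a 0 * a 1) * h / |(D i).det| ∧
      ∀ (x : Fin 2 → ℤ) (z : ℤ), (x ≠ 0 ∨ z ≠ 0) → |(z : ℝ)| < h →
        ∃ r, a r ≤ |D i r 0 * (x 0 + z / 2) + D i r 1 * x 1| := by
    intro i
    rcases hq i with ⟨a, ha, hadm, hqa⟩ | ⟨a, ha, hadm, hqa⟩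
    · refine ⟨1, a, ha, one_pos, by rw [hqa, Fin.prod_univ_two, mul_one], fun x z hxz hz => ?_⟩
      have hz0 : z = 0 := Int.abs_lt_one_iff.1 (by exact_mod_cast hz)
      obtain ⟨r, hr⟩ := hadm x (by simpa [hz0] using hxz)
      exact ⟨r, by simpa [hz0, latVec_fin_two] using hr⟩
    · refine ⟨2, a, ha, two_pos, ?_, fun x z hxz hz => ?_⟩
      · rw [hqa, Fin.prod_univ_two, det_halfMat, abs_div, abs_two]
        field_simp
      · have hz2 : |z| < 2 := by exact_mod_cast hz
        rw [abs_lt] at hz2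
        obtain ⟨r, hr⟩ := hadm ![2 * x 0 + z, x 1] (by
          intro h0
          have h1 : 2 * x 0 + z = 0 := by simpa using congrFun h0 0
          have h2 : x 1 = 0 := by simpa using congrFun h0 1
          rcases hxz with h | h
          · refine h (funext fun r => ?_)
            fin_cases r
            · change x 0 = 0
              omega
            · exact h2
          · omega)
        refine ⟨r, ?_⟩
        rw [latVec_halfMat] at hr
        simp only [Matrix.cons_val_zero, Matrix.cons_val_one] at hr
        push_cast at hr
        convert hr using 3
        ring
  choose h a ha hh hqa hadm using h
  refine ⟨Sum.elim (fun p => a p.2 p.1) (Sum.elim h 1), ?_, ?_, ?_⟩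
  · rintro (⟨r, i⟩ | i | u)
    · exact ha i r
    · exact hh i
    · exact one_pos
  · intro m hm
    by_contra! hlt
    have hz : ∀ i, |(m (.inr (.inl i)) : ℝ)| < h i := fun i => by
      simpa [latVec_glueMat_line] using hlt (.inr (.inl i))
    have hxz : ∀ i, (fun r => m (.inl (r, i))) = 0 ∧ m (.inr (.inl i)) = 0 := by
      intro i
      by_contra hne
      obtain ⟨r, hr⟩ := hadm i (fun r => m (.inl (r, i))) (m (.inr (.inl i))) (by tauto) (hz i)
      have := hlt (.inl (r, i))
      rw [latVec_glueMat_plane] at this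
      exact absurd this (not_lt.2 hr)
    have h0 : m (.inr (.inr ())) = 0 := by
      have := hlt (.inr (.inr ()))
      rw [latVec_glueMat_unit] at this
      replace this : |(m (.inr (.inr ())) : ℝ)| < 1 := by simpa [(hxz _).2] using this
      exact Int.abs_lt_one_iff.1 (by exact_mod_cast this)
    refine hm (funext ?_)
    rintro (⟨r, i⟩ | i | u)
    · exact congrFun (hxz i).1 r
    · exact (hxz i).2
    · exact h0
  · rw [det_glueMat, Fintype.prod_sum_type, Fintype.prod_sum_type, Fintype.prod_prod_type_right,
      Finset.abs_prod]
    simp only [Sum.elim_inl, Sum.elim_inr, Fin.prod_univ_two, Finset.univ_unique,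
      Pi.one_apply, Finset.prod_const_one, mul_one]
    rw [← Finset.prod_mul_distrib, ← Finset.prod_div_distrib]
    exact Finset.prod_congr rfl fun i _ => hqa i

/-- The matrix of the sublattice of the last `k + 1` coordinates with `i`-th coordinate divisible
by `h i`. -/
def lineMat (h : Fin k → ℝ) : Matrix (Fin k ⊕ Unit) (Fin k ⊕ Unit) ℝ :=
  Matrix.fromBlocks (Matrix.diagonal h) 0 (Matrix.of fun _ j => h j / 2) 1

lemma det_lineMat (h : Fin k → ℝ) : (lineMat h).det = ∏ i, h i := by
  simp [lineMat]

lemma latVec_lineMat (h : Fin k → ℤ) (m : Fin k ⊕ Unit → ℤ)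
    (M : (Fin 2 × Fin k) ⊕ (Fin k ⊕ Unit) → ℤ) (h1 : ∀ i, M (.inr (.inl i)) = h i * m (.inl i))
    (h2 : M (.inr (.inr ())) = m (.inr ())) (j : Fin k ⊕ Unit) :
    latVec (lineMat fun i => (h i : ℝ)) m j = latVec (glueMat D) M (.inr j) := by
  rcases j with i | u
  · rw [latVec_glueMat_line, h1]
    simp [latVec, lineMat, Matrix.mulVec, dotProduct, Matrix.diagonal_apply]
  · rw [latVec_glueMat_unit, h2]
    simp only [h1]
    simp [latVec, lineMat, Matrix.mulVec, dotProduct, Finset.sum_div]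
    refine Finset.sum_congr rfl fun i _ => ?_
    ring

lemma le_prod_of_mem_ratioSet_glueMat (hD : ∀ i, (D i).det ≠ 0) {q : ℝ}
    (hq : q ∈ ratioSet (glueMat D)) : q ≤ ∏ i, sSup (pairSet (D i)) := by
  obtain ⟨a, ha, hadm, rfl⟩ := hq
  have key : ∀ i, ∃ h : ℤ, 0 < h ∧
      a (.inl (0, i)) * a (.inl (1, i)) / |(D i).det| * h ≤ sSup (pairSet (D i)) ∧
      ∀ z : ℤ, ∃ x : Fin 2 → ℤ, ∀ r : Fin 2,
        |D i r 0 * (x 0 + ((h * z : ℤ) : ℝ) / 2) + D i r 1 * x 1| < a (.inl (r, i)) := by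
    intro i
    have hadm' : MatAdm (D i) fun r => a (.inl (r, i)) := by
      intro x hx
      obtain ⟨j, hj⟩ := hadm (Sum.elim (fun p => if p.2 = i then x p.1 else 0) 0) (by
        intro h0
        refine hx (funext fun r => ?_)
        simpa using congrFun h0 (.inl (r, i)))
      rcases j with ⟨r, i'⟩ | i' | u
      · rw [latVec_glueMat_plane] at hj
        by_cases hii : i' = i
        · subst hii
          refine ⟨r, ?_⟩
          rw [latVec_fin_two]
          simpa using hj
        · simp [hii] at hj
          exact absurd hj (not_le.2 (ha _))
      · rw [latVec_glueMat_line] at hj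
        simp at hj
        exact absurd hj (not_le.2 (ha _))
      · rw [latVec_glueMat_unit] at hj
        simp at hj
        exact absurd hj (not_le.2 (ha _))
    by_cases hhalf : MatAdm (halfMat (D i)) fun r => a (.inl (r, i))
    · refine ⟨2, two_pos, ?_, fun z => ⟨![-z, 0], fun r => ?_⟩⟩
      · refine le_csSup (bddAbove_pairSet (hD i)) (Or.inr ⟨_, fun r => ha _, hhalf, ?_⟩)
        rw [Fin.prod_univ_two, det_halfMat, abs_div, abs_two]
        push_cast
        field_simp
      · simpa using ha (.inl (r, i))
    · refine ⟨1, one_pos, ?_, fun z => ?_⟩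
      · refine le_csSup (bddAbove_pairSet (hD i)) (Or.inl ⟨_, fun r => ha _, hadm', ?_⟩)
        rw [Fin.prod_univ_two]
        simp
      · simp only [MatAdm, not_forall, not_exists, not_le] at hhalf
        obtain ⟨y, hy, hylt⟩ := hhalf
        simp only [latVec_halfMat] at hylt
        have hodd : Odd (y 0) := by
          by_contra hodd
          obtain ⟨t, ht⟩ := Int.not_odd_iff_even.1 hodd
          obtain ⟨r, hr⟩ := hadm' ![t, y 1] (by
            intro h0
            have h1 : t = 0 := by simpa using congrFun h0 0
            have h2 : y 1 = 0 := by simpa using congrFun h0 1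
            refine hy (funext fun r => ?_)
            fin_cases r
            · change y 0 = 0
              omega
            · exact h2)
          refine absurd (hylt r) (not_lt.2 ?_)
          rw [latVec_fin_two] at hr
          simp only [Matrix.cons_val_zero, Matrix.cons_val_one] at hr
          have hyt : (y 0 : ℝ) / 2 = t := by
            rw [ht]
            push_cast
            ring
          rwa [hyt]
        rcases Int.even_or_odd z with ⟨t, ht⟩ | hz
        · refine ⟨![-t, 0], fun r => ?_⟩
          have := ha (.inl (r, i))
          rw [ht]
          push_cast
          simpa using this
        · obtain ⟨t, ht⟩ := hodd.sub_odd hz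
          refine ⟨![t, y 1], fun r => ?_⟩
          refine lt_of_eq_of_lt (congrArg _ ?_) (hylt r)
          have hyz : (y 0 : ℝ) = z + (t + t) := by
            have : y 0 = z + (t + t) := by omega
            exact_mod_cast this
          rw [hyz]
          simp only [Matrix.cons_val_zero, Matrix.cons_val_one]
          push_cast
          ring
  choose h hpos hle x hx using key
  have hline : MatAdm (lineMat fun i => (h i : ℝ)) fun j => a (.inr j) := by
    intro m hm
    let M : (Fin 2 × Fin k) ⊕ (Fin k ⊕ Unit) → ℤ :=
      Sum.elim (fun p => x p.2 (m (.inl p.2)) p.1)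
        (Sum.elim (fun i => h i * m (.inl i)) fun _ => m (.inr ()))
    obtain ⟨j, hj⟩ := hadm M (by
      intro h0
      refine hm (funext ?_)
      rintro (i | u)
      · have : h i * m (.inl i) = 0 := congrFun h0 (.inr (.inl i))
        exact (mul_eq_zero.1 this).resolve_left (hpos i).ne'
      · exact congrFun h0 (.inr (.inr ())))
    rcases j with ⟨r, i⟩ | j
    · rw [latVec_glueMat_plane] at hj
      exact absurd (hx i (m (.inl i)) r) (not_lt.2 hj)
    · exact ⟨j, by rwa [latVec_lineMat (D := D) h m M (fun _ => rfl) rfl]⟩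
  have hh : ∀ i, (0 : ℝ) < h i := fun i => by exact_mod_cast hpos i
  have hdet : 0 < ∏ i, (h i : ℝ) := Finset.prod_pos fun i _ => hh i
  have hmink := hline.prod_le_det (by rw [det_lineMat]; exact hdet.ne') fun j => ha _
  rw [det_lineMat, abs_of_pos hdet] at hmink
  refine le_trans ?_ (Finset.prod_le_prod (fun i _ => ?_) fun i _ => hle i)
  · rw [det_glueMat, Fintype.prod_sum_type, Fintype.prod_prod_type_right, Finset.abs_prod,
      Finset.prod_mul_distrib, Finset.prod_div_distrib]
    simp only [Fin.prod_univ_two]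
    rw [mul_div_right_comm]
    refine mul_le_mul_of_nonneg_left hmink (div_nonneg ?_ ?_)
    · exact Finset.prod_nonneg fun i _ => (mul_pos (ha _) (ha _)).le
    · exact Finset.prod_nonneg fun i _ => abs_nonneg _
  · exact mul_nonneg (div_nonneg (mul_pos (ha _) (ha _)).le (abs_nonneg _)) (hh i).le

lemma prod_sSup_pairSet_mem_MGhat (hD : ∀ i, (D i).det ≠ 0) (hi : ∀ i, MatIndec (D i))
    (hne : ∀ i, (pairSet (D i)).Nonempty) :
    ∏ i, sSup (pairSet (D i)) ∈
      MGhat (Fintype.card ((Fin 2 × Fin k) ⊕ (Fin k ⊕ Unit))) := by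
  have hdet : (glueMat D).det ≠ 0 := by
    rw [det_glueMat]
    exact Finset.prod_ne_zero_iff.2 fun i _ => hD i
  convert sSup_ratioSet_mem_MGhat (glueMat D) hdet (glueMat_indec hD hi)
  choose u _ hu hmem using fun i => exists_seq_tendsto_sSup (hne i) (bddAbove_pairSet (hD i))
  have hbdd : BddAbove (ratioSet (glueMat D)) := ⟨1, fun _ hq => le_one_of_mem_ratioSet hdet hq⟩
  refine le_antisymm (le_of_tendsto' (tendsto_finsetProd _ fun i _ => hu i) fun n =>
    le_csSup hbdd (prod_mem_ratioSet_glueMat fun i => hmem i n)) ?_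
  exact csSup_le ⟨_, prod_mem_ratioSet_glueMat fun i => (hne i).some_mem⟩ fun q hq =>
    le_prod_of_mem_ratioSet_glueMat hD hq

end glue

/-- The matrix of the lattice of pairs `(m + n √d, m - n √d)`. -/
def pellMat (d : ℕ) : Matrix (Fin 2) (Fin 2) ℝ := !![1, √d; 1, -√d]

lemma det_pellMat (d : ℕ) : (pellMat d).det = -2 * √d := by
  simp [pellMat, Matrix.det_fin_two]; ring

lemma det_pellMat_ne_zero {d : ℕ} (hd : 0 < d) : (pellMat d).det ≠ 0 := by
  rw [det_pellMat]
  have : 0 < √(d : ℝ) := Real.sqrt_pos.2 (by exact_mod_cast hd)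
  exact mul_ne_zero (by norm_num) this.ne'

lemma one_le_abs_sq_sub_mul_sq {d : ℕ} (hd : ¬ IsSquare (d : ℤ)) {m n : ℤ} (h : m ≠ 0 ∨ n ≠ 0) :
    1 ≤ |m ^ 2 - d * n ^ 2| := by
  refine Int.one_le_abs fun h0 => hd ?_
  have hmn : m ^ 2 = d * n ^ 2 := by linarith
  have hn : n ≠ 0 := by
    rintro rfl
    have : m = 0 := by simpa using hmn
    simp_all
  obtain ⟨t, rfl⟩ := (Int.pow_dvd_pow_iff two_ne_zero).1 (Dvd.intro_left _ hmn.symm)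
  refine ⟨t, mul_right_cancel₀ (pow_ne_zero 2 hn) ?_⟩
  rw [← hmn]
  ring

lemma latVec_pellMat_mul (d : ℕ) (m : Fin 2 → ℤ) :
    latVec (pellMat d) m 0 * latVec (pellMat d) m 1 = ((m 0 ^ 2 - d * m 1 ^ 2 : ℤ) : ℝ) := by
  simp only [latVec_fin_two, pellMat, Matrix.of_apply, Matrix.cons_val_zero, Matrix.cons_val_one]
  push_cast
  linear_combination (-(m 1 : ℝ) ^ 2) * Real.sq_sqrt (Nat.cast_nonneg d : (0 : ℝ) ≤ d)

lemma latVec_halfMat_pellMat_mul (d : ℕ) (m : Fin 2 → ℤ) :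
    latVec (halfMat (pellMat d)) m 0 * latVec (halfMat (pellMat d)) m 1 =
      ((m 0 ^ 2 - d * (2 * m 1) ^ 2 : ℤ) : ℝ) / 4 := by
  simp only [latVec_halfMat, pellMat, Matrix.of_apply, Matrix.cons_val_zero, Matrix.cons_val_one]
  push_cast
  linear_combination (-(m 1 : ℝ) ^ 2) * Real.sq_sqrt (Nat.cast_nonneg d : (0 : ℝ) ≤ d)

lemma fin_two_ne_zero {m : Fin 2 → ℤ} (hm : m ≠ 0) : m 0 ≠ 0 ∨ m 1 ≠ 0 := by
  by_contra! h
  exact hm (funext fun i => by fin_cases i <;> simp [h])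

lemma matIndec_of_no_axis_vector {D : Matrix (Fin 2) (Fin 2) ℝ} (y : Fin 2 → ℤ)
    (h0 : ∀ x, latVec D y 0 = latVec D x 0 → latVec D x 1 ≠ 0)
    (h1 : ∀ x, latVec D y 1 = latVec D x 1 → latVec D x 0 ≠ 0) : MatIndec D := by
  rintro s ⟨i, hi⟩ ⟨j, hj⟩
  refine ⟨y, fun x hx => ?_⟩
  have hxi := congrFun hx i
  have hxj := congrFun hx j
  rw [Set.indicator_of_mem hi] at hxi
  rw [Set.indicator_of_notMem hj] at hxj
  fin_cases i <;> fin_cases j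
  · exact hj hi
  · exact h0 x hxi hxj.symm
  · exact h1 x hxi hxj.symm
  · exact hj hi

lemma pellMat_indec {d : ℕ} (hd : ¬ IsSquare (d : ℤ)) : MatIndec (pellMat d) := by
  have key : ∀ x : Fin 2 → ℤ, x ≠ 0 → latVec (pellMat d) x 0 * latVec (pellMat d) x 1 ≠ 0 := by
    intro x hx h
    rw [latVec_pellMat_mul] at h
    have h1 : x 0 ^ 2 - d * x 1 ^ 2 = 0 := by exact_mod_cast h
    have := one_le_abs_sq_sub_mul_sq hd (fin_two_ne_zero hx)
    rw [h1] at this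
    norm_num at this
  have hy : latVec (pellMat d) ![1, 0] 0 = 1 ∧ latVec (pellMat d) ![1, 0] 1 = 1 := by
    simp [latVec_fin_two, pellMat]
  refine matIndec_of_no_axis_vector ![1, 0] (fun x hx h => ?_) fun x hx h => ?_
  · refine key x ?_ (by rw [h, mul_zero])
    rintro rfl
    rw [hy.1, latVec_zero] at hx
    exact one_ne_zero hx
  · refine key x ?_ (by rw [h, zero_mul])
    rintro rfl
    rw [hy.2, latVec_zero] at hx
    exact one_ne_zero hx

lemma sSup_pairSet_pellMat_lt_one {d : ℕ} (hd0 : 0 < d) (hd : ¬ IsSquare (d : ℤ))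
    (hne : (pairSet (pellMat d)).Nonempty) : sSup (pairSet (pellMat d)) < 1 := by
  have hdet := det_pellMat_ne_zero hd0
  have hV := abs_pos.2 hdet
  obtain ⟨δ₁, hδ₁, h₁⟩ := exists_gap_of_norm_ge hdet (c := 1 / |(pellMat d).det|) (by positivity) (by
    intro m hm
    rw [latVec_pellMat_mul, one_div_mul_cancel hV.ne']
    exact_mod_cast one_le_abs_sq_sub_mul_sq hd (fin_two_ne_zero hm))
  have hdet' := det_halfMat_ne_zero hdet
  have hV' := abs_pos.2 hdet'
  obtain ⟨δ₂, hδ₂, h₂⟩ := exists_gap_of_norm_ge hdet'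
    (c := 1 / 4 / |(halfMat (pellMat d)).det|) (by positivity) (by
    intro m hm
    rw [latVec_halfMat_pellMat_mul, div_mul_cancel₀ _ hV'.ne', abs_div]
    have : (1 : ℝ) ≤ |((m 0 ^ 2 - d * (2 * m 1) ^ 2 : ℤ) : ℝ)| := by
      exact_mod_cast one_le_abs_sq_sub_mul_sq hd
        ((fin_two_ne_zero hm).imp_right fun h => mul_ne_zero two_ne_zero h)
    rw [abs_of_pos (four_pos : (0 : ℝ) < 4)]
    linarith)
  refine lt_of_le_of_lt (csSup_le hne (a := 1 - min δ₁ δ₂) ?_) (by simp [hδ₁, hδ₂])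
  rintro q (hq | hq)
  · linarith [h₁ q hq, min_le_left δ₁ δ₂]
  · linarith [h₂ q hq, min_le_right δ₁ δ₂]

lemma mem_pairSet_pellMat {N : ℕ} (hN : 1 ≤ N) :
    (N + √((N ^ 2 + 1 : ℕ) : ℝ)) / (2 * √((N ^ 2 + 1 : ℕ) : ℝ)) ∈
      pairSet (pellMat (N ^ 2 + 1)) := by
  set e : ℝ := √((N ^ 2 + 1 : ℕ) : ℝ) with he
  have hN' : (1 : ℝ) ≤ N := by exact_mod_cast hN
  have he2 : e ^ 2 = N ^ 2 + 1 := by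
    rw [he, Real.sq_sqrt (Nat.cast_nonneg _)]
    push_cast
    rfl
  have he0 : 0 ≤ e := Real.sqrt_nonneg _
  have heN : (N : ℝ) < e := by nlinarith
  have heN1 : e < N + 1 := by nlinarith
  refine Or.inl ⟨![N + e, 1], ?_, ?_, ?_⟩
  · intro i
    fin_cases i
    · change 0 < (N : ℝ) + e
      linarith
    · exact one_pos
  · intro m hm
    by_contra! h
    have h0 : |(m 0 : ℝ) + e * m 1| < N + e := by
      have := h 0
      rw [latVec_fin_two] at this
      simpa only [pellMat, Matrix.of_apply, Matrix.cons_val_zero, Matrix.cons_val_one, one_mul,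
        ← he] using this
    have h1 : |(m 0 : ℝ) - e * m 1| < 1 := by
      have := h 1
      rw [latVec_fin_two] at this
      simpa only [pellMat, Matrix.of_apply, Matrix.cons_val_zero, Matrix.cons_val_one, one_mul,
        neg_mul, ← sub_eq_add_neg, ← he] using this
    rw [abs_lt] at h0 h1
    have hn : |(m 1 : ℝ)| < 2 := by
      rw [abs_lt]
      constructor <;> nlinarith
    have hn' : |m 1| < 2 := by exact_mod_cast hn
    rw [abs_lt] at hn'
    obtain h' | h' | h' : m 1 = -1 ∨ m 1 = 0 ∨ m 1 = 1 := by omega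
    · rw [h'] at h0 h1
      push_cast at h0 h1
      have h2 : m 0 < -(N : ℤ) + 1 := by exact_mod_cast (by linarith : (m 0 : ℝ) < -(N : ℝ) + 1)
      have h3 : (m 0 : ℝ) ≤ -N := by exact_mod_cast (by omega : m 0 ≤ -(N : ℤ))
      linarith
    · rw [h'] at h1
      have h2 : |(m 0 : ℝ)| < 1 := by rw [abs_lt]; constructor <;> push_cast at h1 <;> linarith
      have h3 : m 0 = 0 := Int.abs_lt_one_iff.1 (by exact_mod_cast h2)
      exact (fin_two_ne_zero hm).elim (fun h => h h3) fun h => h h'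
    · rw [h'] at h0 h1
      push_cast at h0 h1
      have h2 : (N : ℤ) - 1 < m 0 := by exact_mod_cast (by linarith : (N : ℝ) - 1 < m 0)
      have h3 : (N : ℝ) ≤ m 0 := by exact_mod_cast (by omega : (N : ℤ) ≤ m 0)
      linarith
  · rw [Fin.prod_univ_two, det_pellMat, ← he, abs_mul, abs_of_nonneg he0]
    norm_num

/-- The values attached to planar lattices which can be used as factors in the construction. -/
def factorSet : Set ℝ :=
  {c | ∃ D : Matrix (Fin 2) (Fin 2) ℝ, D.det ≠ 0 ∧ MatIndec D ∧ (pairSet D).Nonempty ∧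
    c = sSup (pairSet D)}

lemma pos_of_mem_factorSet {c : ℝ} (hc : c ∈ factorSet) : 0 < c := by
  obtain ⟨D, hD, -, ⟨q, hq⟩, rfl⟩ := hc
  exact (pos_of_mem_pairSet hD hq).trans_le (le_csSup (bddAbove_pairSet hD) hq)

lemma one_mem_factorSet : (1 : ℝ) ∈ factorSet := by
  let D : Matrix (Fin 2) (Fin 2) ℝ := !![1, 1 / 2; 0, 1]
  have hdet : D.det = 1 := by simp [D, Matrix.det_fin_two]
  have hD : D.det ≠ 0 := by rw [hdet]; exact one_ne_zero
  have hD0 : ∀ m, latVec D m 0 = m 0 + m 1 / 2 := fun m => by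
    rw [latVec_fin_two]; simp [D]; ring
  have hD1 : ∀ m, latVec D m 1 = m 1 := fun m => by rw [latVec_fin_two]; simp [D]
  have h1 : (1 : ℝ) ∈ pairSet D := by
    refine Or.inl ⟨1, fun _ => one_pos, fun m hm => ?_, by simp [hdet]⟩
    by_contra! h
    have h1 : |latVec D m 1| < 1 := h 1
    rw [hD1] at h1
    have h1' : m 1 = 0 := Int.abs_lt_one_iff.1 (by exact_mod_cast h1)
    have h0 : |latVec D m 0| < 1 := h 0
    rw [hD0, h1', Int.cast_zero, zero_div, add_zero] at h0
    have h0' : m 0 = 0 := Int.abs_lt_one_iff.1 (by exact_mod_cast h0)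
    exact (fin_two_ne_zero hm).elim (fun h => h h0') fun h => h h1'
  refine ⟨D, hD, ?_, ⟨1, h1⟩, ?_⟩
  · refine matIndec_of_no_axis_vector ![0, 1] (fun x hx h => ?_) fun x hx h => ?_
    · rw [hD1] at h
      rw [hD0, hD0, h] at hx
      simp only [Matrix.cons_val_zero, Matrix.cons_val_one] at hx
      push_cast at hx
      have h2 : (1 : ℝ) = 2 * x 0 := by linarith
      have h3 : 1 = 2 * x 0 := by exact_mod_cast h2
      omega
    · rw [hD1, hD1] at hx
      rw [hD0, ← hx] at h
      simp only [Matrix.cons_val_one] at h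
      push_cast at h
      have h2 : 2 * (x 0 : ℝ) + 1 = 0 := by linarith
      have h3 : 2 * x 0 + 1 = 0 := by exact_mod_cast h2
      omega
  · exact le_antisymm (le_csSup (bddAbove_pairSet hD) h1)
      (csSup_le ⟨1, h1⟩ fun q hq => le_one_of_mem_pairSet hD hq)

lemma exists_mem_factorSet_between {x : ℝ} (hx : x < 1) : ∃ c ∈ factorSet, x < c ∧ c < 1 := by
  obtain ⟨N, hN⟩ := exists_nat_gt (1 / (1 - x))
  have hx' : 0 < 1 - x := by linarith
  have hN0 : (0 : ℝ) < N := lt_trans (by positivity) hN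
  have hN1 : 1 ≤ N := by exact_mod_cast hN0
  have hmem := mem_pairSet_pellMat hN1
  have hdet : (pellMat (N ^ 2 + 1)).det ≠ 0 := det_pellMat_ne_zero (by positivity)
  have hsq : ¬ IsSquare ((N ^ 2 + 1 : ℕ) : ℤ) := by
    rintro ⟨r, hr⟩
    push_cast at hr
    have h1 : (1 : ℤ) ≤ N := by exact_mod_cast hN1
    have h2 : (|r|) * |r| = N ^ 2 + 1 := by rw [abs_mul_abs_self, hr]
    have h3 : (N : ℤ) < |r| := by nlinarith [abs_nonneg r]
    nlinarith
  refine ⟨_, ⟨_, hdet, pellMat_indec hsq, ⟨_, hmem⟩, rfl⟩, ?_,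
    sSup_pairSet_pellMat_lt_one (by positivity) hsq ⟨_, hmem⟩⟩
  refine lt_of_lt_of_le ?_ (le_csSup (bddAbove_pairSet hdet) hmem)
  set e : ℝ := √((N ^ 2 + 1 : ℕ) : ℝ) with he
  have he2 : e ^ 2 = N ^ 2 + 1 := by
    rw [he, Real.sq_sqrt (Nat.cast_nonneg _)]
    push_cast
    rfl
  have heN : (N : ℝ) < e := by nlinarith [Real.sqrt_nonneg ((N ^ 2 + 1 : ℕ) : ℝ)]
  rw [lt_div_iff₀ (by linarith)]
  rw [div_lt_iff₀ hx'] at hN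
  nlinarith

lemma prod_mem_incrDeriv {ι : Type*} [Fintype ι] [DecidableEq ι] {K S : Set ℝ}
    (hpos : ∀ c ∈ K, 0 < c) {u : ℕ → ℝ} (hu : StrictMono u) (huK : ∀ n, u n ∈ K)
    (hlim : Tendsto u atTop (𝓝 1)) (hS : ∀ f : ι → ℝ, (∀ i, f i ∈ K) → ∏ i, f i ∈ S) (r : ℕ)
    (f : ι → ℝ) (hf : ∀ i, f i ∈ K) (s : Finset ι) (hs : s.card = r) (hfs : ∀ i ∈ s, f i = 1) :
    ∏ i, f i ∈ incrDeriv S r := by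
  induction r generalizing f s with
  | zero => exact hS f hf
  | succ r ih =>
    obtain ⟨i, hi⟩ := Finset.card_pos.1 (by omega : 0 < s.card)
    have hcard : (s.erase i).card = r := by rw [Finset.card_erase_of_mem hi]; omega
    have hprod : ∀ c, ∏ j, Function.update f i c j = c * ∏ j ∈ Finset.univ \ {i}, f j :=
      fun c => Finset.prod_update_of_mem (Finset.mem_univ i) _ _
    refine ⟨ih f hf (s.erase i) hcard fun j hj => hfs j (Finset.mem_of_mem_erase hj),
      fun n => ∏ j, Function.update f i (u n) j, fun n => ?_, ?_, ?_⟩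
    · refine ih _ (fun j => ?_) (s.erase i) hcard fun j hj => ?_
      · by_cases h : j = i
        · subst h
          simpa using huK n
        · simpa [h] using hf j
      · rw [Function.update_of_ne (Finset.ne_of_mem_erase hj)]
        exact hfs j (Finset.mem_of_mem_erase hj)
    · simp only [hprod]
      exact hu.mul_const (Finset.prod_pos fun j _ => hpos _ (hf j))
    · have : ∏ j, f j = 1 * ∏ j ∈ Finset.univ \ {i}, f j := by
        rw [← hprod, ← hfs i hi, Function.update_eq_self]
      rw [this]
      simp only [hprod]
      exact hlim.mul_const _

/-- For every natural number `t` there exists `n` such that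
`1 ∈ M̂G_n^{(t)}`. -/
theorem one_mem_iterated_incrDeriv_MGhat (t : ℕ) :
    ∃ n : ℕ, (1 : ℝ) ∈ incrDeriv (MGhat n) t := by
  have hlub : IsLUB (factorSet ∩ Set.Iio 1) 1 := by
    refine ⟨fun c hc => hc.2.le, fun b hb => ?_⟩
    by_contra! h
    obtain ⟨c, hc, hbc, hc1⟩ := exists_mem_factorSet_between h
    exact absurd (hb ⟨hc, hc1⟩) (not_le.2 hbc)
  obtain ⟨c, hc, -, hc1⟩ := exists_mem_factorSet_between (zero_lt_one (α := ℝ))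
  obtain ⟨u, hu, -, hlim, huK⟩ := hlub.exists_seq_strictMono_tendsto_of_notMem
    (fun h => lt_irrefl (1 : ℝ) h.2) ⟨c, hc, hc1⟩
  refine ⟨Fintype.card ((Fin 2 × Fin t) ⊕ (Fin t ⊕ Unit)), ?_⟩
  have := prod_mem_incrDeriv (ι := Fin t) (fun c => pos_of_mem_factorSet) hu (fun n => (huK n).1)
    hlim (S := MGhat (Fintype.card ((Fin 2 × Fin t) ⊕ (Fin t ⊕ Unit)))) (by
      intro f hf
      choose D hD hi hne hfD using hf
      simp only [hfD]
      exact prod_sSup_pairSet_mem_MGhat hD hi hne) t 1 (fun _ => one_mem_factorSet) Finset.univ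
    (by simp) (fun _ _ => rfl)
  simpa using this

end
end

section
/- Let F be a number field of degree d over ℚ, let σ₁,…,σ_d : F → ℂ be its distinct field embeddings, and let k₁,…,k_d ∈ ℤ be such that ∏_{i=1}^d σ_i(x)^{k_i} ∈ ℚ for every nonzero x ∈ F. Then k₁ = k₂ = ⋯ = k_d. -/
open scoped BigOperators

namespace Polynomial

theorem rootMultiplicity_prod_X_sub_C_pow {K ι : Type*} [Field K] [Fintype ι] {a : ι → K}
    (ha : Function.Injective a) (n : ι → ℕ) (j : ι) :
    rootMultiplicity (a j) (∏ i, (X - C (a i)) ^ n i) = n j := by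
  classical
  have hne (i : ι) : (X - C (a i)) ^ n i ≠ 0 := pow_ne_zero _ (X_sub_C_ne_zero _)
  rw [← count_roots, roots_prod _ _ (Finset.prod_ne_zero_iff.2 fun i _ => hne i),
    Multiset.count_bind]
  change ∑ i, _ = _
  rw [Finset.sum_eq_single j]
  · simp
  · intro i _ hij
    simp [(ha.ne hij).symm]
  · simp

/-- If `∏ i, (m - a i) ^ n i` is fixed by `τ` for all natural numbers `m`, then the exponents
of `τ`-conjugate elements agree. -/
theorem exponent_eq_of_forall_natCast_map_eq {K ι : Type*} [Field K] [CharZero K] [Fintype ι]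
    {a : ι → K} (ha : Function.Injective a) (n : ι → ℕ) (τ : K ≃+* K)
    (h : ∀ m : ℕ, τ (∏ i, ((m : K) - a i) ^ n i) = ∏ i, ((m : K) - a i) ^ n i)
    {i j : ι} (hij : τ (a i) = a j) : n i = n j := by
  have hP : (∏ i, (X - C (τ (a i))) ^ n i) = ∏ i, (X - C (a i)) ^ n i := by
    refine eq_of_infinite_eval_eq _ _ ?_
    refine (Set.infinite_range_of_injective (Nat.cast_injective (R := K))).mono ?_
    rintro _ ⟨m, rfl⟩
    simpa [eval_prod] using h m
  have h1 := rootMultiplicity_prod_X_sub_C_pow (τ.injective.comp ha) n i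
  simp only [Function.comp_apply] at h1
  rw [hP, hij, rootMultiplicity_prod_X_sub_C_pow ha] at h1
  exact h1.symm

end Polynomial

namespace NumberField

variable {F : Type*} [Field F] [NumberField F]

theorem prod_embeddings_eq_norm {ι : Type*} [Fintype ι] {σ : ι → (F →+* ℂ)}
    (hσ : Function.Bijective σ) (x : F) : ∏ i, σ i x = (Algebra.norm ℚ x : ℂ) := by
  have h := Algebra.norm_eq_prod_embeddings ℚ ℂ x
  rw [eq_ratCast] at h
  rw [h, hσ.prod_comp (fun φ : F →+* ℂ => φ x)]
  exact Fintype.prod_equiv (RingHom.equivRatAlgHom F ℂ) (fun φ : F →+* ℂ => φ x)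
    (fun φ : F →ₐ[ℚ] ℂ => φ x) fun _ => rfl

theorem exponents_eq_of_prod_embeddings_pow_rat {ι : Type*} [Fintype ι] {σ : ι → (F →+* ℂ)}
    (hσ : Function.Injective σ) (n : ι → ℕ)
    (h : ∀ x : F, ∃ q : ℚ, ∏ i, σ i x ^ n i = (q : ℂ)) (i j : ι) : n i = n j := by
  obtain ⟨α, hα⟩ := Field.exists_primitive_element ℚ F
  let L := algebraicClosure ℚ ℂ
  have hint : IsIntegral ℚ α := Algebra.IsIntegral.isIntegral α
  have hmem (i : ι) : σ i α ∈ L :=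
    mem_algebraicClosure_iff.2 ((hint.map (σ i).toRatAlgHom).isAlgebraic)
  let a : ι → L := fun i => ⟨σ i α, hmem i⟩
  have ha : Function.Injective a := by
    intro i j hij
    have hij' : σ i α = σ j α := congrArg Subtype.val hij
    apply hσ
    have halg : (σ i).toRatAlgHom = (σ j).toRatAlgHom := by
      refine AlgHom.ext_of_adjoin_eq_top (s := {α}) ?_ ?_
      · rw [← IntermediateField.adjoin_simple_toSubalgebra_of_isAlgebraic hint.isAlgebraic, hα,
          IntermediateField.top_toSubalgebra]
      · rintro _ rfl
        exact hij'
    ext x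
    exact DFunLike.congr_fun halg x
  have hmin (i : ι) : minpoly ℚ (a i) = minpoly ℚ α := by
    refine (minpoly.algHom_eq (L.val : L →+* ℂ).toRatAlgHom L.val.injective (a i)).symm.trans ?_
    exact minpoly.algHom_eq (σ i).toRatAlgHom (σ i).injective α
  have hnormal : Normal ℚ L := by
    convert @IsAlgClosure.normal ℚ L _ _ _ (algebraicClosure.isAlgClosure ℚ ℂ)
  have hconj : IsConjRoot ℚ (a j) (a i) := (hmin j).trans (hmin i).symm
  obtain ⟨τ, hτ⟩ := isConjRoot_iff_exists_algEquiv.1 hconj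
  refine Polynomial.exponent_eq_of_forall_natCast_map_eq ha n τ.toRingEquiv (fun m => ?_)
    (i := i) (j := j) ?_
  · obtain ⟨q, hq⟩ := h (m - α)
    have hL : ∏ i, ((m : L) - a i) ^ n i = algebraMap ℚ L q := by
      apply L.val.injective
      simpa [a] using hq
    rw [hL]
    exact τ.commutes q
  · exact hτ

end NumberField

/-- Let `F` be a number field of degree `d` over `ℚ`, let
`σ₁, …, σ_d : F → ℂ` be its distinct field embeddings, and let `k₁, …, k_d ∈ ℤ` be
such that `∏ i, σ i x ^ k i ∈ ℚ` for every nonzero `x ∈ F`. Then all the `k i`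
are equal. -/
theorem prod_embeddings_zpow_rat_imp_exponents_eq
    (F : Type*) [Field F] [NumberField F] (d : ℕ)
    (hd : Module.finrank ℚ F = d)
    (σ : Fin d → (F →+* ℂ)) (hσ : Function.Injective σ)
    (k : Fin d → ℤ)
    (hk : ∀ x : F, x ≠ 0 → ∃ q : ℚ, ∏ i, (σ i x) ^ (k i) = (q : ℂ)) :
    ∀ i j, k i = k j := by
  have hbij : Function.Bijective σ :=
    (Fintype.bijective_iff_injective_and_card σ).2
      ⟨hσ, by rw [NumberField.Embeddings.card, hd, Fintype.card_fin]⟩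
  obtain ⟨N, hN⟩ : ∃ N : ℤ, ∀ i, 0 ≤ k i + N :=
    ⟨∑ i, |k i|, fun i => by
      have := Finset.single_le_sum (fun i _ => abs_nonneg (k i)) (Finset.mem_univ i)
      have := neg_abs_le (k i)
      linarith⟩
  choose n hn using fun i => Int.eq_ofNat_of_zero_le (hN i)
  have hrat (x : F) : ∃ q : ℚ, ∏ i, σ i x ^ n i = (q : ℂ) := by
    rcases eq_or_ne x 0 with rfl | hx
    · exact ⟨∏ i, 0 ^ n i, by simp⟩
    · obtain ⟨q, hq⟩ := hk x hx
      refine ⟨q * Algebra.norm ℚ x ^ N, ?_⟩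
      push_cast
      rw [← hq, ← NumberField.prod_embeddings_eq_norm hbij, ← Finset.prod_zpow,
        ← Finset.prod_mul_distrib]
      refine Finset.prod_congr rfl fun i _ => ?_
      rw [← zpow_add₀ ((map_ne_zero (σ i)).2 hx), hn, zpow_natCast]
  intro i j
  have hij := NumberField.exponents_eq_of_prod_embeddings_pow_rat hσ n hrat i j
  have hi := hn i
  have hj := hn j
  omega
end

section
/- The Mordell–Gruber spectrum in dimension 2, MG₂ = {κ(Λ) : Λ ⊆ ℝ² a lattice}, has an accumulation point that is strictly smaller than 1. -/
open MeasureTheory Filter Topology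

noncomputable section

/-- The Mordell–Gruber spectrum in dimension 2. -/
def MG2 : Set ℝ :=
  {r | ∃ Λ : AddSubgroup (Fin 2 → ℝ), IsLattice Λ ∧ r = mordell Λ}

/-- Let `V` be (the points of) a planar lattice with consecutive minimal vectors `(X, -σ y)`,
`(x, σ Y)` such that the continued fraction of `x / X` only has the partial quotients `1` and `2`.
Then every admissible box with sides `a ≤ X` and `b` has small volume. -/
lemma mul_le_of_partial_quotients_le_two {V : ℝ → ℝ → Prop} {S : Set ℝ} {a b D : ℝ}
    (hV : ∀ x y x' y', V x y → V x' y' → V (x - x') (y - y'))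
    (hS : ∀ s ∈ S, 1 / 3 ≤ s ∧ s ≤ 3 / 4 ∧ ∃ t ∈ S, s * (1 + t) = 1 ∨ s * (2 + t) = 1)
    (hadm : ∀ x y, V x y → x ≠ 0 → |x| < a → b ≤ |y|) (n : ℕ) :
    ∀ {X x Y y s σ : ℝ}, V X (-(σ * y)) → V x (σ * Y) → |σ| = 1 → 0 < X → 0 < Y → Y ≤ 3 * y →
      y ≤ Y → s ∈ S → x = s * X → X * Y + x * y = D → X * (3 / 4) ^ n < a → a ≤ X →
      a * b ≤ 9 / 10 * D := by
  induction n with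
  | zero => intros; simp_all; linarith
  | succ n ih =>
    intro X x Y y s σ hP hQ hσ hX hY hy hyY hs hx hD hn ha
    obtain ⟨h1, h2, t, ht, hst⟩ := hS s hs
    have hx0 : 0 < x := by rw [hx]; positivity
    rcases lt_or_ge x a with hxa | hax
    · have hb := hadm x _ hQ hx0.ne' (by rwa [abs_of_pos hx0])
      rw [abs_mul, hσ, one_mul, abs_of_pos hY] at hb
      have ha0 : 0 < a := hx0.trans hxa
      have h4 : a * b ≤ X * Y := by
        calc a * b ≤ a * Y := by gcongr
          _ ≤ X * Y := by gcongr
      have h5 : X / 3 ≤ x := by rw [hx]; nlinarith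
      have h6 : X / 3 * (Y / 3) ≤ x * y := by
        apply mul_le_mul h5 (by linarith) (by positivity) hx0.le
      nlinarith
    · have hn' : x * (3 / 4) ^ n < a := by
        refine lt_of_le_of_lt ?_ hn
        have : x ≤ X * (3 / 4) := by rw [hx]; nlinarith
        calc x * (3 / 4) ^ n ≤ X * (3 / 4) * (3 / 4) ^ n := by gcongr
          _ = _ := by ring
      rcases hst with hst | hst
      · refine ih (X := x) (x := X - x) (Y := y + Y) (y := Y) (s := t) (σ := -σ) ?_ ?_ ?_ hx0
          ?_ ?_ ?_ ht ?_ ?_ hn' hax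
        · simpa using hQ
        · convert hV _ _ _ _ hP hQ using 1; ring
        · simpa using hσ
        · linarith
        · linarith
        · linarith
        · rw [hx]; linear_combination -X * hst
        · linear_combination hD
      · refine ih (X := x) (x := X - x - x) (Y := y + 2 * Y) (y := Y) (s := t) (σ := -σ) ?_ ?_ ?_
          hx0 ?_ ?_ ?_ ht ?_ ?_ hn' hax
        · simpa using hQ
        · convert hV _ _ _ _ (hV _ _ _ _ hP hQ) hQ using 1; ring
        · simpa using hσ
        · linarith
        · linarith
        · linarith
        · rw [hx]; linear_combination -X * hst
        · linear_combination hD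

/-- The basis `(1, -β)`, `(α, 1)` of the plane. -/
def planeBasis (α β : ℝ) (h : 0 < 1 + α * β) : Module.Basis (Fin 2) ℝ (Fin 2 → ℝ) :=
  basisOfLinearIndependentOfCardEqFinrank (b := ![![1, -β], ![α, 1]])
    (by
      have : (Matrix.of ![![1, -β], ![α, 1]]).det ≠ 0 := by
        rw [Matrix.det_fin_two]
        simp
        linarith
      exact Matrix.linearIndependent_rows_of_det_ne_zero this) (by simp)

/-- The lattice generated by `(1, -β)` and `(α, 1)`. -/
def planeLattice (α β : ℝ) (h : 0 < 1 + α * β) : AddSubgroup (Fin 2 → ℝ) :=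
  (Submodule.span ℤ (Set.range (planeBasis α β h))).toAddSubgroup

lemma mem_planeLattice {α β : ℝ} {h : 0 < 1 + α * β} {v : Fin 2 → ℝ} :
    v ∈ planeLattice α β h ↔ ∃ p q : ℤ, v = ![p + q * α, -p * β + q] := by
  have hr : Set.range (planeBasis α β h) = {![1, -β], ![α, 1]} := by
    simp [planeBasis, Set.pair_comm]
  rw [planeLattice, Submodule.mem_toAddSubgroup, hr, Submodule.mem_span_pair]
  refine exists_congr fun p => exists_congr fun q => ?_
  rw [eq_comm]
  simp

lemma compactSpace_quotient_span {n : ℕ} (b : Module.Basis (Fin n) ℝ (Fin n → ℝ)) :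
    CompactSpace ((Fin n → ℝ) ⧸ (Submodule.span ℤ (Set.range b)).toAddSubgroup) := by
  have hK : IsCompact (closure (ZSpan.fundamentalDomain b)) :=
    (ZSpan.fundamentalDomain_isBounded b).isCompact_closure
  refine ⟨?_⟩
  have : (Set.univ : Set ((Fin n → ℝ) ⧸ (Submodule.span ℤ (Set.range b)).toAddSubgroup)) =
      QuotientAddGroup.mk '' closure (ZSpan.fundamentalDomain b) := by
    refine (Set.eq_univ_of_forall fun q => ?_).symm
    induction q using QuotientAddGroup.induction_on with
    | H x =>
      refine ⟨ZSpan.fract b x, subset_closure (ZSpan.fract_mem_fundamentalDomain b x), ?_⟩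
      rw [QuotientAddGroup.eq]
      simp [ZSpan.fract]
  rw [this]
  exact hK.image continuous_quotient_mk'

lemma isLattice_planeLattice {α β : ℝ} (h : 0 < 1 + α * β) : IsLattice (planeLattice α β h) :=
  ⟨inferInstanceAs (DiscreteTopology
    (Submodule.span ℤ (Set.range (planeBasis α β h))).toAddSubgroup),
    compactSpace_quotient_span _⟩

lemma covol_planeLattice {α β : ℝ} (h : 0 < 1 + α * β) :
    covol (planeLattice α β h) = 1 + α * β := by
  have h1 : AddSubgroup.toIntSubmodule (planeLattice α β h) =
      Submodule.span ℤ (Set.range (planeBasis α β h)) := rfl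
  rw [covol, h1, ZLattice.covolume_eq_det _ ((planeBasis α β h).restrictScalars ℤ),
    Matrix.det_fin_two]
  have h2 : planeBasis α β h 0 = ![1, -β] := by simp [planeBasis]
  have h3 : planeBasis α β h 1 = ![α, 1] := by simp [planeBasis]
  simp [h2, h3, mul_comm β α, abs_of_pos h]

lemma isAdmissible_planeLattice {α β : ℝ} (h : 0 < 1 + α * β) (hα : 0 ≤ α) (hβ : 0 ≤ β) :
    IsAdmissible (planeLattice α β h) ![1, 1] := by
  intro v hv hv0 hlt
  obtain ⟨p, q, rfl⟩ := mem_planeLattice.1 hv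
  have h0 := abs_lt.1 (hlt 0)
  have h1 := abs_lt.1 (hlt 1)
  simp only [Matrix.cons_val_zero, Matrix.cons_val_one] at h0 h1
  apply hv0
  have hp : p = 0 := by
    by_contra hp
    rcases lt_or_gt_of_ne hp with hp | hp
    · have hp' : (p : ℝ) ≤ -1 := by exact_mod_cast (by omega : p ≤ -1)
      rcases lt_or_ge q 1 with hq | hq
      · have hq' : (q : ℝ) ≤ 0 := by exact_mod_cast (by omega : q ≤ 0)
        nlinarith
      · have hq' : (1 : ℝ) ≤ q := by exact_mod_cast hq
        nlinarith
    · have hp' : (1 : ℝ) ≤ p := by exact_mod_cast hp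
      rcases lt_or_ge q 0 with hq | hq
      · have hq' : (q : ℝ) ≤ -1 := by exact_mod_cast (by omega : q ≤ -1)
        nlinarith
      · have hq' : (0 : ℝ) ≤ q := by exact_mod_cast hq
        nlinarith
  subst hp
  have hq : q = 0 := by
    have h2 : (-1 : ℝ) < q := by simpa using h1.1
    have h3 : (q : ℝ) < 1 := by simpa using h1.2
    have h2' : -1 < q := by exact_mod_cast h2
    have h3' : q < 1 := by exact_mod_cast h3
    omega
  subst hq
  ext i
  fin_cases i <;> simp

lemma exists_mul_three_quarters_pow_lt (X : ℝ) {a : ℝ} (hX : 0 < X) (ha : 0 < a) :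
    ∃ n : ℕ, X * (3 / 4) ^ n < a := by
  obtain ⟨n, hn⟩ := exists_pow_lt_of_lt_one (div_pos ha hX) (by norm_num : (3 / 4 : ℝ) < 1)
  exact ⟨n, by rwa [lt_div_iff₀' hX] at hn⟩

lemma mordell_planeLattice {α β c g : ℝ} {S : Set ℝ}
    (hS : ∀ s ∈ S, 1 / 3 ≤ s ∧ s ≤ 3 / 4 ∧ ∃ t ∈ S, s * (1 + t) = 1 ∨ s * (2 + t) = 1)
    (hc : c ∈ S) (hg : g ∈ S) (hα : α * (2 + c) = 1) (hβ : β * (9 + g) = 1)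
    (hg2 : g * (1 + g) = 1) (h : 0 < 1 + α * β) :
    mordell (planeLattice α β h) = 1 / (1 + α * β) := by
  obtain ⟨hc1, hc2, -⟩ := hS c hc
  obtain ⟨hg1, hg2', -⟩ := hS g hg
  have hα0 : 0 < α := by nlinarith
  have hβ0 : 0 < β := by nlinarith
  have hα1 : α ≤ 3 / 7 := by nlinarith
  have hβ1 : β ≤ 3 / 28 := by nlinarith
  have hαβ : α * β ≤ 1 / 9 := by nlinarith
  have hg3 : 1 / 2 < g := by nlinarith
  have hP : ![1, -β] ∈ planeLattice α β h := mem_planeLattice.2 ⟨1, 0, by simp⟩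
  refine IsGreatest.csSup_eq ⟨⟨![1, 1], ?_, isAdmissible_planeLattice h hα0.le hβ0.le, ?_⟩, ?_⟩
  · intro i; fin_cases i <;> simp
  · simp [covol_planeLattice]
  · rintro k ⟨a, ha, hadm, rfl⟩
    rw [covol_planeLattice, Fin.prod_univ_two]
    gcongr
    have ha0 := ha 0
    have ha1 := ha 1
    set A := a 0
    set B := a 1
    have key : ∀ x y, ![x, y] ∈ planeLattice α β h → ![x, y] ≠ 0 → |x| < A → B ≤ |y| := by
      intro x y hv h0 hx
      by_contra! hy
      refine hadm _ hv h0 fun i => ?_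
      fin_cases i
      · simpa using hx
      · simpa using hy
    have hQ : ![α, 1] ∈ planeLattice α β h := mem_planeLattice.2 ⟨0, 1, by simp⟩
    rcases le_or_gt A 1 with hA | hA
    · rcases lt_or_ge α A with h1 | h1
      · have := key α 1 hQ (by simp) (by rwa [abs_of_pos hα0])
        rw [abs_one] at this
        nlinarith
      · obtain ⟨n, hn⟩ := exists_mul_three_quarters_pow_lt α hα0 ha0
        have := mul_le_of_partial_quotients_le_two (S := S) (D := 1 + α * β) (a := A) (b := B)
          (V := fun x y => ![x, y] ∈ planeLattice α β h)
          (fun x y x' y' hv hv' => by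
            have := sub_mem hv hv'
            simpa using this) hS
          (fun x y hv hx => key x y hv (by simp [hx])) n (X := α) (x := 1 - 2 * α) (Y := 2 + β)
          (y := 1) (s := c) (σ := -1) (by simpa using hQ)
          (mem_planeLattice.2 ⟨1, -2, by ext i; fin_cases i <;> [(simp; ring); simp]⟩) (by simp)
          hα0 (by linarith) (by linarith) (by linarith) hc (by linear_combination -hα)
          (by ring) hn h1
        linarith
    · have hB := key 1 (-β) hP (by simp) (by simpa using hA)
      rw [abs_neg, abs_of_pos hβ0] at hB
      rcases lt_or_ge (g * β) B with h1 | h1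
      · have hA : A ≤ 9 + α := by
          by_contra! hA
          have := key (9 + α) (g * β) (mem_planeLattice.2 ⟨9, 1, by
            ext i; fin_cases i <;> [simp; (simp; linear_combination hβ)]⟩)
            (by
              intro h0
              have := congrFun h0 0
              simp at this
              linarith) (by rwa [abs_of_pos (by linarith)])
          rw [abs_of_pos (by positivity)] at this
          linarith
        calc A * B ≤ (9 + α) * β := by gcongr
          _ ≤ 1 := by nlinarith
      · have hgβ : 0 < g * β := by positivity
        obtain ⟨n, hn⟩ := exists_mul_three_quarters_pow_lt (g * β) hgβ ha1
        have := mul_le_of_partial_quotients_le_two (S := S) (D := 1 + α * β) (a := B) (b := A)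
          (V := fun y x => ![x, y] ∈ planeLattice α β h)
          (fun y x y' x' hv hv' => by
            have := sub_mem hv hv'
            simpa using this) hS
          (fun y x hv hy hyB => by
            by_contra! hx
            exact absurd (key x y hv (by simp [hy]) hx) (not_le.2 hyB)) n (X := g * β)
          (x := g * (g * β)) (Y := 10 + α)
          (y := 9 + α) (s := g) (σ := -1)
          (mem_planeLattice.2 ⟨9, 1, by
            ext i; fin_cases i <;> [simp; (simp; linear_combination hβ)]⟩)
          (mem_planeLattice.2 ⟨-10, -1, by
            ext i; fin_cases i <;> simp
            · ring
            · linear_combination -hβ + β * hg2⟩) (by simp)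
          hgβ (by linarith) (by linarith) (by linarith) hg rfl
          (by linear_combination (9 + α) * β * hg2 + hβ) hn h1
        linarith

/-- The numbers `[0; 1, …, 1, 2 + g]` with `n` partial quotients equal to `1`. -/
def oneTail (g : ℝ) : ℕ → ℝ
  | 0 => 1 / (2 + g)
  | n + 1 => 1 / (1 + oneTail g n)

lemma oneTail_bounds {g : ℝ} (hg1 : 1 / 3 ≤ g) (hg2 : g ≤ 3 / 4) (n : ℕ) :
    1 / 3 ≤ oneTail g n ∧ oneTail g n ≤ 3 / 4 := by
  induction n with
  | zero =>
    rw [oneTail, le_div_iff₀ (by linarith), div_le_iff₀ (by linarith)]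
    constructor <;> linarith
  | succ n ih =>
    rw [oneTail, le_div_iff₀ (by linarith), div_le_iff₀ (by linarith)]
    constructor <;> linarith

lemma oneTail_injective {g : ℝ} (hg1 : 1 / 3 ≤ g) (hg2 : g ≤ 3 / 4) :
    Function.Injective (oneTail g) := by
  have hne : ∀ n, oneTail g 0 ≠ oneTail g (n + 1) := by
    intro n hn
    obtain ⟨h1, h2⟩ := oneTail_bounds hg1 hg2 n
    rw [oneTail, oneTail, div_eq_div_iff (by linarith) (by linarith)] at hn
    linarith
  intro m
  induction m with
  | zero =>
    intro n hn
    cases n with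
    | zero => rfl
    | succ n => exact absurd hn (hne n)
  | succ m ih =>
    intro n hn
    cases n with
    | zero => exact absurd hn.symm (hne m)
    | succ n =>
      have h1 := (oneTail_bounds hg1 hg2 n).1
      have h2 := (oneTail_bounds hg1 hg2 m).1
      rw [oneTail, oneTail, div_eq_div_iff (by linarith) (by linarith)] at hn
      rw [ih (by linarith : oneTail g m = oneTail g n)]

/-- The Mordell–Gruber spectrum `MG₂ = {κ(Λ) : Λ ⊆ ℝ² a lattice}`
has an accumulation point which is strictly smaller than `1`. -/
theorem MG2_has_accumulation_point_lt_one :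
    ∃ x : ℝ, x < 1 ∧ x ∈ closure (MG2 \ {x}) := by
  obtain ⟨g, hg1, hg2, hg⟩ : ∃ g : ℝ, 1 / 3 ≤ g ∧ g ≤ 3 / 4 ∧ g * (1 + g) = 1 := by
    have h5 : √5 ^ 2 = (5 : ℝ) := Real.sq_sqrt (by norm_num)
    have h50 := Real.sqrt_nonneg 5
    refine ⟨(√5 - 1) / 2, by nlinarith, by nlinarith, by nlinarith⟩
  have hb := oneTail_bounds hg1 hg2
  have hS : ∀ s ∈ insert g (Set.range (oneTail g)), 1 / 3 ≤ s ∧ s ≤ 3 / 4 ∧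
      ∃ t ∈ insert g (Set.range (oneTail g)), s * (1 + t) = 1 ∨ s * (2 + t) = 1 := by
    rintro s (rfl | ⟨n, rfl⟩)
    · exact ⟨hg1, hg2, s, Set.mem_insert _ _, Or.inl hg⟩
    · refine ⟨(hb n).1, (hb n).2, ?_⟩
      cases n with
      | zero =>
        exact ⟨g, Set.mem_insert _ _, Or.inr (one_div_mul_cancel (by linarith))⟩
      | succ n =>
        have := (hb n).1
        exact ⟨oneTail g n, Or.inr ⟨n, rfl⟩, Or.inl (one_div_mul_cancel (by linarith))⟩
  set f : ℕ → ℝ := fun n => 1 / (1 + 1 / (2 + oneTail g n) * (1 / (9 + g)))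
  have hpos : ∀ n, 1 / 40 < 1 / (2 + oneTail g n) * (1 / (9 + g)) := by
    intro n
    have := hb n
    rw [one_div_mul_one_div, one_div_lt_one_div (by norm_num) (by nlinarith)]
    nlinarith
  have hmem : ∀ n, f n ∈ MG2 := by
    intro n
    have h := hpos n
    have := (hb n).1
    have h' : 0 < 1 + 1 / (2 + oneTail g n) * (1 / (9 + g)) := by linarith
    refine ⟨planeLattice _ _ h', isLattice_planeLattice h', ?_⟩
    exact (mordell_planeLattice hS (Or.inr ⟨n, rfl⟩) (Set.mem_insert _ _)
      (one_div_mul_cancel (by linarith)) (one_div_mul_cancel (by linarith)) hg h').symm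
  have hinj : Function.Injective f := by
    intro m n hmn
    have h1 := (hb m).1
    have h2 := (hb n).1
    simp only [f, one_div, inv_inj, add_right_inj] at hmn
    have h3 := mul_right_cancel₀ (inv_ne_zero (by linarith)) hmn
    rw [inv_inj, add_right_inj] at h3
    exact oneTail_injective hg1 hg2 h3
  obtain ⟨x, hx, hacc⟩ := (Set.infinite_range_of_injective hinj).exists_accPt_of_subset_isCompact
    (isCompact_Icc (a := (0 : ℝ)) (b := 40 / 41)) (by
      rintro _ ⟨n, rfl⟩
      have := hpos n
      refine ⟨one_div_nonneg.2 (by linarith), ?_⟩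
      rw [div_le_iff₀ (by linarith)]
      linarith)
  refine ⟨x, by linarith [hx.2], ?_⟩
  rw [accPt_principal_iff_clusterPt, ← mem_closure_iff_clusterPt] at hacc
  exact closure_mono (Set.sdiff_subset_sdiff_left (by rintro _ ⟨n, rfl⟩; exact hmem n)) hacc

end
end
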